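/- For all x, y ∈ ℝ² and all t ≥ 0: W_c(μ_x^t, μ_y^t) ≤ min(|x−y|, |x+y|), i.e. the heat kernel embedding of the cone C(π) is 1-Lipschitz from the cone distance to the cone Wasserstein distance. -/

import Mathlib

open MeasureTheory ENNReal

/-- A coupling of two measures: a measure on the product whose marginals are the two
given measures. -/
def IsCoupling {Y : Type*} [MeasurableSpace Y] (π : Measure (Y × Y)) (μ ν : Measure Y) : Prop :=
  π.map Prod.fst = μ ∧ π.map Prod.snd = ν

/-- The (squared) optimal transport cost for the quadratic cost built from `c`. -/
noncomputable def transportCost {Y : Type*} [MeasurableSpace Y] (c : Y → Y → ℝ)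
    (μ ν : Measure Y) : ℝ≥0∞ :=
  ⨅ (π : Measure (Y × Y)) (_ : IsCoupling π μ ν), ∫⁻ p, ENNReal.ofReal (c p.1 p.2 ^ 2) ∂π

/-- The `L²`-Wasserstein distance associated to the cost `c`. -/
noncomputable def W2 {Y : Type*} [MeasurableSpace Y] (c : Y → Y → ℝ) (μ ν : Measure Y) : ℝ :=
  Real.sqrt (transportCost c μ ν).toReal

/-- A measure on a metric space has finite second moment. -/
def HasFiniteSecondMoment {X : Type*} [MetricSpace X] [MeasurableSpace X] (μ : Measure X) :
    Prop :=
  ∃ x₀ : X, ∫⁻ x, ENNReal.ofReal (dist x₀ x ^ 2) ∂μ < ⊤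

/-- A partition `0 = s 0 < s 1 < ⋯ < s N = 1` of `[0,1]`. -/
def IsPartition (N : ℕ) (s : ℕ → ℝ) : Prop :=
  s 0 = 0 ∧ s N = 1 ∧ ∀ i < N, s i < s (i + 1)

/-- The length of the curve `γ : [0,1] → Y` with respect to the distance `ρ`, as the
supremum over partitions of sums of consecutive `ρ`-distances. -/
noncomputable def curveLength {Y : Type*} (ρ : Y → Y → ℝ) (γ : ℝ → Y) : ℝ≥0∞ :=
  ⨆ (N : ℕ) (s : ℕ → ℝ) (_ : IsPartition N s),
    ENNReal.ofReal (∑ i ∈ Finset.range N, ρ (γ (s i)) (γ (s (i + 1))))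

/-- Continuity of a curve `γ : [0,1] → Y` with respect to the distance `ρ`. -/
def RhoContinuousCurve {Y : Type*} (ρ : Y → Y → ℝ) (γ : ℝ → Y) : Prop :=
  ∀ s ∈ Set.Icc (0:ℝ) 1, ∀ ε > 0, ∃ δ > 0, ∀ s' ∈ Set.Icc (0:ℝ) 1,
    |s' - s| < δ → ρ (γ s) (γ s') < ε

/-- The length distance induced by the distance `ρ`. -/
noncomputable def lengthDist {Y : Type*} (ρ : Y → Y → ℝ) (x y : Y) : ℝ≥0∞ :=
  ⨅ (γ : ℝ → Y) (_ : RhoContinuousCurve ρ γ ∧ γ 0 = x ∧ γ 1 = y), curveLength ρ γ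

/-- A metric space is a length space: the distance coincides with the induced length
distance. -/
def IsLengthSpace (X : Type*) [MetricSpace X] : Prop :=
  ∀ x y : X, lengthDist (fun a b => dist a b) x y = ENNReal.ofReal (dist x y)

/-- The Gaussian measure on `ℝ²` centered at `x` with variance `2t` (heat kernel at
time `t`). -/
noncomputable def gauss2 (t : ℝ) (x : EuclideanSpace ℝ (Fin 2)) :
    Measure (EuclideanSpace ℝ (Fin 2)) :=
  volume.withDensity fun y =>
    ENNReal.ofReal ((4 * Real.pi * t)⁻¹ * Real.exp (-‖y - x‖ ^ 2 / (4 * t)))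

/-- The symmetric lift `μ_x^t = ½(γ_x^t + γ_{-x}^t)` of the heat kernel measure on the
cone `C(π)` centered at the class of `x` (with `μ_x^0 = ½(δ_x + δ_{-x})`). -/
noncomputable def symGauss (t : ℝ) (x : EuclideanSpace ℝ (Fin 2)) :
    Measure (EuclideanSpace ℝ (Fin 2)) :=
  if t = 0 then (2 : ℝ≥0∞)⁻¹ • (Measure.dirac x + Measure.dirac (-x))
  else (2 : ℝ≥0∞)⁻¹ • (gauss2 t x + gauss2 t (-x))

/-- The cone cost on `ℝ²`: the lift of the cone distance of `C(π)`. -/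
noncomputable def coneCost (x y : EuclideanSpace ℝ (Fin 2)) : ℝ :=
  min ‖x - y‖ ‖x + y‖

theorem gauss2_eq_map_add (t : ℝ) (x : EuclideanSpace ℝ (Fin 2)) :
    gauss2 t x = (gauss2 t 0).map (· + x) := by
  ext s hs
  rw [Measure.map_apply (measurable_add_const x) hs, gauss2, gauss2, withDensity_apply _ hs,
    withDensity_apply _ (measurable_add_const x hs),
    ← (measurePreserving_add_right volume x).setLIntegral_comp_preimage hs (by fun_prop)]
  simp

theorem gauss2_univ {t : ℝ} (ht : 0 < t) (x : EuclideanSpace ℝ (Fin 2)) :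
    gauss2 t x Set.univ = 1 := by
  rw [gauss2_eq_map_add, Measure.map_apply (measurable_add_const x) .univ, Set.preimage_univ,
    gauss2, withDensity_apply _ .univ, Measure.restrict_univ]
  have hb : 0 < (4 * t)⁻¹ := by positivity
  have key := GaussianFourier.integral_rexp_neg_mul_sq_norm
    (V := EuclideanSpace ℝ (Fin 2)) hb
  have hint : Integrable fun v : EuclideanSpace ℝ (Fin 2) => Real.exp (-(4 * t)⁻¹ * ‖v‖ ^ 2) := by
    refine .of_integral_ne_zero ?_
    rw [key]
    positivity
  have hfun : (fun v : EuclideanSpace ℝ (Fin 2) => -‖v - 0‖ ^ 2 / (4 * t)) =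
      fun v => -(4 * t)⁻¹ * ‖v‖ ^ 2 := by
    ext v
    rw [sub_zero]
    ring
  simp only [fun v => congrFun hfun v]
  rw [← ofReal_integral_eq_lintegral_ofReal (hint.const_mul _)
    (.of_forall fun v => by positivity), integral_const_mul, key]
  rw [finrank_euclideanSpace_fin]
  norm_num
  field_simp

/-- The symmetric lifts at a fixed time are symmetrized translates of one probability measure. -/
theorem exists_symGauss_eq_map {t : ℝ} (ht : 0 ≤ t) :
    ∃ m : Measure (EuclideanSpace ℝ (Fin 2)), IsProbabilityMeasure m ∧
      ∀ x, symGauss t x = (2 : ℝ≥0∞)⁻¹ • (m.map (· + x) + m.map (· + -x)) := by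
  rcases ht.eq_or_lt with rfl | ht
  · refine ⟨Measure.dirac 0, inferInstance, fun x => ?_⟩
    rw [symGauss, if_pos rfl, Measure.map_dirac' (measurable_add_const _),
      Measure.map_dirac' (measurable_add_const _), zero_add, zero_add]
  · refine ⟨gauss2 t 0, ⟨gauss2_univ ht 0⟩, fun x => ?_⟩
    rw [symGauss, if_neg ht.ne', gauss2_eq_map_add t x, gauss2_eq_map_add t (-x)]

theorem symGauss_neg (t : ℝ) (x : EuclideanSpace ℝ (Fin 2)) :
    symGauss t (-x) = symGauss t x := by
  simp only [symGauss, neg_neg, add_comm]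

theorem measurable_coneCost :
    Measurable fun p : EuclideanSpace ℝ (Fin 2) × EuclideanSpace ℝ (Fin 2) =>
      coneCost p.1 p.2 := by
  unfold coneCost
  fun_prop

theorem coneCost_sq_le (x y : EuclideanSpace ℝ (Fin 2)) :
    coneCost x y ^ 2 ≤ ‖x - y‖ ^ 2 :=
  pow_le_pow_left₀ (le_min (norm_nonneg _) (norm_nonneg _)) (min_le_left _ _) 2

theorem transportCost_symGauss_le (x y : EuclideanSpace ℝ (Fin 2)) {t : ℝ} (ht : 0 ≤ t) :
    transportCost coneCost (symGauss t x) (symGauss t y) ≤ ENNReal.ofReal (‖x - y‖ ^ 2) := by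
  obtain ⟨m, _, hm⟩ := exists_symGauss_eq_map ht
  have hpair (a b : EuclideanSpace ℝ (Fin 2)) : Measurable fun w => (w + a, w + b) := by fun_prop
  have hcost (a b : EuclideanSpace ℝ (Fin 2)) (hab : ‖a - b‖ = ‖x - y‖) :
      ∫⁻ p, ENNReal.ofReal (coneCost p.1 p.2 ^ 2) ∂m.map (fun w => (w + a, w + b)) ≤
        ENNReal.ofReal (‖x - y‖ ^ 2) := by
    rw [lintegral_map (measurable_coneCost.pow_const 2).ennreal_ofReal (hpair a b)]
    calc ∫⁻ w, ENNReal.ofReal (coneCost (w + a) (w + b) ^ 2) ∂m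
        ≤ ∫⁻ _, ENNReal.ofReal (‖x - y‖ ^ 2) ∂m := by
          refine lintegral_mono fun w => ENNReal.ofReal_le_ofReal ?_
          simpa [hab] using coneCost_sq_le (w + a) (w + b)
      _ = ENNReal.ofReal (‖x - y‖ ^ 2) := by simp
  refine iInf₂_le_of_le ((2 : ℝ≥0∞)⁻¹ • (m.map (fun w => (w + x, w + y)) +
    m.map (fun w => (w + -x, w + -y)))) ⟨?_, ?_⟩ ?_
  · rw [hm x, Measure.map_smul, Measure.map_add _ _ measurable_fst,
      Measure.map_map measurable_fst (hpair _ _), Measure.map_map measurable_fst (hpair _ _)]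
    rfl
  · rw [hm y, Measure.map_smul, Measure.map_add _ _ measurable_snd,
      Measure.map_map measurable_snd (hpair _ _), Measure.map_map measurable_snd (hpair _ _)]
    rfl
  · rw [lintegral_smul_measure, lintegral_add_measure, smul_eq_mul]
    refine (mul_le_mul_right (add_le_add (hcost x y rfl) (hcost (-x) (-y) ?_)) _).trans_eq ?_
    · rw [← neg_sub', norm_neg]
    · rw [← two_mul, ← mul_assoc, ENNReal.inv_mul_cancel two_ne_zero ofNat_ne_top, one_mul]

theorem W2_symGauss_le_norm_sub (x y : EuclideanSpace ℝ (Fin 2)) {t : ℝ} (ht : 0 ≤ t) :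
    W2 coneCost (symGauss t x) (symGauss t y) ≤ ‖x - y‖ :=
  Real.sqrt_le_iff.2 ⟨norm_nonneg _,
    ENNReal.toReal_le_of_le_ofReal (by positivity) (transportCost_symGauss_le x y ht)⟩

/-- the heat kernel embedding of the cone `C(π)` is 1-Lipschitz from the
cone distance to the cone Wasserstein distance. -/
theorem stmt6 :
    ∀ (x y : EuclideanSpace ℝ (Fin 2)) (t : ℝ), 0 ≤ t →
      W2 coneCost (symGauss t x) (symGauss t y) ≤ min ‖x - y‖ ‖x + y‖ := by
  intro x y t ht
  refine le_min (W2_symGauss_le_norm_sub x y ht) ?_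
  simpa [symGauss_neg] using W2_symGauss_le_norm_sub x (-y) ht
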